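/- (Exponential de Finetti theorem, tensor-power version.) Let d ≥ 1, n ≥ k ≥ 1, and set δ := k(d+k)/n; assume δ < 1. Then there exist real numbers x_0, x_1, …, x_k with |x_s| ≤ (2δ)^s/(1−δ) for every s, such that for every operator ρ on (ℂ^d)^{⊗n} with P_sym^{(d,n)} ρ P_sym^{(d,n)} = ρ, one has tr_{last n-k}(ρ) = Σ_{s=0}^{k} x_s · Clone_{k-s→k}( MP_{n→k-s}(ρ) ). -/

import Mathlib

open MeasureTheory Matrix

open scoped ComplexOrder

noncomputable section

/-- Operators on `(ℂ^d)^{⊗m}`. -/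
abbrev MatP (d m : ℕ) := Matrix (Fin m → Fin d) (Fin m → Fin d) ℂ

/-- The operator `P_d(π)` on `(ℂ^d)^{⊗m}` permuting tensor factors. -/
def permMat (d m : ℕ) (π : Equiv.Perm (Fin m)) : MatP d m :=
  fun a b => if ∀ t, a t = b (π⁻¹ t) then 1 else 0

/-- The orthogonal projector `P_sym^{(d,m)} = (1/m!) ∑_{π ∈ S_m} P_d(π)` onto the
symmetric subspace `∨^m ℂ^d`. -/
def psym (d m : ℕ) : MatP d m :=
  (m.factorial : ℂ)⁻¹ • ∑ π : Equiv.Perm (Fin m), permMat d m π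

/-- `d_sym(m) = C(d+m-1, m)`, the dimension of `∨^m ℂ^d`. -/
def dsym (d m : ℕ) : ℕ := Nat.choose (d + m - 1) m

/-- `M ⊗ I_d^{⊗q}`, extending an operator on the first `p` factors by the identity. -/
def extendId (d p q : ℕ) (M : MatP d p) : MatP d (p + q) :=
  fun a b =>
    M (fun i => a (Fin.castAdd q i)) (fun i => b (Fin.castAdd q i)) *
      (if ∀ i : Fin q, a (Fin.natAdd p i) = b (Fin.natAdd p i) then 1 else 0)

/-- Partial trace over the first `p` tensor factors. -/
def trFirstPart (d p q : ℕ) (M : MatP d (p + q)) : MatP d q :=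
  fun a b => ∑ c : Fin p → Fin d,
    M (Fin.addCases (motive := fun _ => Fin d) c a)
      (Fin.addCases (motive := fun _ => Fin d) c b)

/-- Partial trace over the last `q` tensor factors. -/
def trLastPart (d p q : ℕ) (M : MatP d (p + q)) : MatP d p :=
  fun a b => ∑ c : Fin q → Fin d,
    M (Fin.addCases (motive := fun _ => Fin d) a c)
      (Fin.addCases (motive := fun _ => Fin d) b c)

/-- Transport an operator along an equality of the number of tensor factors. -/
def recast (d : ℕ) {m m' : ℕ} (h : m = m') (M : MatP d m) : MatP d m' :=
  Matrix.reindex (Equiv.arrowCongr (finCongr h) (Equiv.refl (Fin d)))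
    (Equiv.arrowCongr (finCongr h) (Equiv.refl (Fin d))) M

/-- The optimal measure-and-prepare channel
`MP_{n→j}(ρ) = (d_sym(n)/d_sym(n+j)) · tr_{first n}[P_sym^{(d,n+j)} (ρ ⊗ I^{⊗j})]`. -/
def MP (d n j : ℕ) (ρ : MatP d n) : MatP d j :=
  ((dsym d n : ℂ) / (dsym d (n + j) : ℂ)) •
    trFirstPart d n j (psym d (n + j) * extendId d n j ρ)

/-- The optimal cloning channel
`Clone_{s→s+j}(σ) = (d_sym(s)/d_sym(s+j)) · P_sym^{(d,s+j)} (σ ⊗ I^{⊗j}) P_sym^{(d,s+j)}`. -/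
def clone (d s j : ℕ) (σ : MatP d s) : MatP d (s + j) :=
  ((dsym d s : ℂ) / (dsym d (s + j) : ℂ)) •
    (psym d (s + j) * extendId d s j σ * psym d (s + j))

/-- The tensor power `u^{⊗m}` of a vector `u`, in coordinates. -/
def tensorPow {d : ℕ} (m : ℕ) (u : Fin d → ℂ) : (Fin m → Fin d) → ℂ :=
  fun a => ∏ i, u (a i)

/-- Ryser's formula: the permanent as an alternating sum over sets of columns. -/
theorem sum_perm_prod_eq_sum_finset {R : Type*} [CommRing R] {m : ℕ}
    (A : Fin m → Fin m → R) :
    ∑ π : Equiv.Perm (Fin m), ∏ i, A i (π i) =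
      ∑ S : Finset (Fin m), (-1) ^ (Sᶜ).card * ∏ i, ∑ t ∈ S, A i t := by
  have h1 : ∀ S : Finset (Fin m), ∏ i, ∑ t ∈ S, A i t =
      ∑ f : Fin m → Fin m, if Finset.univ.image f ⊆ S then ∏ i, A i (f i) else 0 := by
    intro S
    rw [Finset.prod_univ_sum, ← Finset.sum_filter]
    refine Finset.sum_congr ?_ fun _ _ => rfl
    ext f
    simp [Finset.image_subset_iff, Fintype.mem_piFinset]
  have h2 : ∀ f : Fin m → Fin m,
      ∑ S : Finset (Fin m), (-1 : R) ^ (Sᶜ).card *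
        (if Finset.univ.image f ⊆ S then ∏ i, A i (f i) else 0) =
      if Function.Bijective f then ∏ i, A i (f i) else 0 := by
    intro f
    have h3 : ∑ S : Finset (Fin m), (-1 : R) ^ (Sᶜ).card *
        (if Finset.univ.image f ⊆ S then ∏ i, A i (f i) else 0) =
        (∑ T ∈ (Finset.univ.image f)ᶜ.powerset, (-1 : R) ^ T.card) * ∏ i, A i (f i) := by
      rw [Finset.sum_mul, ← Finset.sum_subset (Finset.subset_univ
        ((Finset.univ.image f)ᶜ.powerset.image fun T => Tᶜ)), Finset.sum_image]
      · refine Finset.sum_congr rfl fun T hT => ?_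
        rw [if_pos, compl_compl]
        rw [Finset.mem_powerset] at hT
        exact Finset.subset_compl_comm.mp hT
      · intro x _ y _ h
        exact compl_injective h
      · intro S _ hS
        rw [if_neg, mul_zero]
        intro h
        apply hS
        rw [Finset.mem_image]
        exact ⟨Sᶜ, by simpa using h, compl_compl S⟩
    have h4 := congrArg (Int.cast : ℤ → R)
      (Finset.sum_powerset_neg_one_pow_card (x := (Finset.univ.image f)ᶜ))
    push_cast at h4
    rw [h3, h4]
    have h5 : (Finset.univ.image f)ᶜ = ∅ ↔ Function.Bijective f := by
      rw [Finset.compl_eq_empty_iff, ← Finite.surjective_iff_bijective]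
      simp [Finset.ext_iff, Function.Surjective]
    by_cases hf : Function.Bijective f
    · rw [if_pos (h5.2 hf), if_pos hf, one_mul]
    · rw [if_neg (fun h => hf (h5.1 h)), if_neg hf, zero_mul]
  simp_rw [h1, Finset.mul_sum]
  rw [Finset.sum_comm]
  simp_rw [h2]
  rw [← Finset.sum_filter]
  symm
  refine Finset.sum_bij' (fun f hf => Equiv.ofBijective f (Finset.mem_filter.1 hf).2)
    (fun π _ => π) ?_ ?_ ?_ ?_ ?_
  · simp
  · intro π _; exact Finset.mem_filter.2 ⟨Finset.mem_univ _, π.bijective⟩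
  · intros; rfl
  · intros; ext; rfl
  · intros; rfl

theorem permMat_apply (d m : ℕ) (π : Equiv.Perm (Fin m)) (a b : Fin m → Fin d) :
    permMat d m π a b = if b = a ∘ π then 1 else 0 := by
  unfold permMat
  congr 1
  rw [eq_iff_iff]
  constructor
  · intro h
    funext t
    simp [h (π t)]
  · rintro rfl t
    simp

theorem psym_mulVec (d m : ℕ) (f : (Fin m → Fin d) → ℂ) (a : Fin m → Fin d) :
    (psym d m *ᵥ f) a = (m.factorial : ℂ)⁻¹ * ∑ π : Equiv.Perm (Fin m), f (a ∘ π) := by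
  simp only [psym, smul_mulVec, Pi.smul_apply, smul_eq_mul, sum_mulVec, Finset.sum_apply]
  congr 1
  refine Finset.sum_congr rfl fun π _ => ?_
  simp [mulVec, dotProduct, permMat_apply]

theorem psym_transpose (d m : ℕ) : (psym d m)ᵀ = psym d m := by
  ext a b
  simp only [psym, transpose_apply, Matrix.smul_apply, Matrix.sum_apply, smul_eq_mul]
  congr 1
  refine Fintype.sum_equiv (Equiv.inv _) _ _ fun π => ?_
  simp only [permMat_apply, Equiv.inv_apply]
  congr 1
  rw [eq_iff_iff]
  constructor
  · rintro rfl; ext; simp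
  · rintro rfl; ext; simp

theorem psym_mulVec_tensorPow {d : ℕ} (m : ℕ) (u : Fin d → ℂ) :
    psym d m *ᵥ tensorPow m u = tensorPow m u := by
  ext a
  have h : ∀ π : Equiv.Perm (Fin m), tensorPow m u (a ∘ π) = tensorPow m u a := fun π =>
    Equiv.prod_comp π fun i => u (a i)
  rw [psym_mulVec]
  simp [h, Fintype.card_perm, Nat.factorial_ne_zero]

theorem tensorPow_vecMul_psym {d : ℕ} (m : ℕ) (u : Fin d → ℂ) :
    tensorPow m u ᵥ* psym d m = tensorPow m u := by
  rw [← mulVec_transpose, psym_transpose, psym_mulVec_tensorPow]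

/-- Polarization: the columns of the symmetric projector are combinations of tensor powers. -/
theorem psym_apply_eq_sum_tensorPow (d m : ℕ) (a b : Fin m → Fin d) :
    psym d m a b = ∑ S : Finset (Fin m), ((m.factorial : ℂ)⁻¹ * (-1) ^ (Sᶜ).card) *
      tensorPow m (∑ t ∈ S, Pi.single (b t) 1) a := by
  have h := sum_perm_prod_eq_sum_finset
    (fun i t => (Pi.single (b t) 1 : Fin d → ℂ) (a i))
  simp only [mul_assoc, ← Finset.mul_sum, tensorPow, Finset.sum_apply]
  rw [← h, psym_transpose d m |>.symm]
  simp only [psym, transpose_apply, Matrix.smul_apply, Matrix.sum_apply, smul_eq_mul]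
  congr 1
  refine Finset.sum_congr rfl fun π _ => ?_
  simp only [permMat_apply, Pi.single_apply]
  rw [Finset.prod_ite_zero]
  simp [funext_iff]

theorem psym_mul_self (d m : ℕ) : psym d m * psym d m = psym d m := by
  ext a b
  rw [mul_apply]
  simp_rw [psym_apply_eq_sum_tensorPow d m _ b, Finset.mul_sum]
  rw [Finset.sum_comm]
  refine Finset.sum_congr rfl fun S _ => ?_
  rw [Finset.sum_congr rfl fun c _ => mul_left_comm (psym d m a c) _ _, ← Finset.mul_sum]
  exact congrArg _ (congrFun (psym_mulVec_tensorPow m _) a)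

/-- Linear maps agreeing on all `|φ^{⊗n}⟩⟨ψ^{⊗n}|` agree on operators on the symmetric subspace. -/
theorem eq_of_eq_on_tensorPow {V : Type*} [AddCommGroup V] [Module ℂ V] {d n : ℕ}
    (L R : MatP d n →ₗ[ℂ] V)
    (h : ∀ φ ψ : Fin d → ℂ, L (vecMulVec (tensorPow n φ) (tensorPow n ψ)) =
      R (vecMulVec (tensorPow n φ) (tensorPow n ψ)))
    {ρ : MatP d n} (hρ : psym d n * ρ * psym d n = ρ) : L ρ = R ρ := by
  have key : ρ = ∑ a, ∑ b, ∑ S : Finset (Fin n), ∑ T : Finset (Fin n),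
      (ρ a b * ((n.factorial : ℂ)⁻¹ * (-1) ^ (Sᶜ).card) *
        ((n.factorial : ℂ)⁻¹ * (-1) ^ (Tᶜ).card)) •
      vecMulVec (tensorPow n (∑ t ∈ S, Pi.single (a t) 1))
        (tensorPow n (∑ t ∈ T, Pi.single (b t) 1)) := by
    conv_lhs => rw [← hρ]
    ext x y
    simp only [mul_apply, Finset.sum_mul, Matrix.sum_apply, Matrix.smul_apply, vecMulVec_apply,
      smul_eq_mul]
    rw [Finset.sum_comm]
    refine Finset.sum_congr rfl fun a _ => Finset.sum_congr rfl fun b _ => ?_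
    rw [psym_apply_eq_sum_tensorPow d n x a, ← psym_transpose, transpose_apply,
      psym_apply_eq_sum_tensorPow d n y b, Finset.sum_mul, Finset.sum_mul]
    refine Finset.sum_congr rfl fun S _ => ?_
    rw [Finset.mul_sum]
    refine Finset.sum_congr rfl fun T _ => ?_
    ring
  rw [key]
  simp only [map_sum, map_smul, h]

/-- The value `⟨u^{⊗m}, M v^{⊗m}⟩` (bilinear, no conjugation). -/
def symForm {d m : ℕ} (M : MatP d m) (u v : Fin d → ℂ) : ℂ :=
  tensorPow m u ⬝ᵥ (M *ᵥ tensorPow m v)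

theorem eq_of_symForm_eq {d m : ℕ} {M M' : MatP d m}
    (hM : psym d m * M * psym d m = M) (hM' : psym d m * M' * psym d m = M')
    (h : ∀ u v, symForm M u v = symForm M' u v) : M = M' := by
  have hform : ∀ (N : MatP d m) (u v : Fin d → ℂ),
      ((Nᵀ * vecMulVec (tensorPow m u) (tensorPow m v)).trace) = symForm N u v := by
    intro N u v
    rw [mul_vecMulVec, trace_vecMulVec, mulVec_transpose, symForm, dotProduct_mulVec]
  have hent : ∀ N : MatP d m, psym d m * N * psym d m = N → ∀ a b,
      (Nᵀ * (psym d m * Matrix.single a b 1 * psym d m)).trace = N a b := by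
    intro N hN a b
    have : (Nᵀ * (psym d m * Matrix.single a b 1 * psym d m)).trace =
        ((psym d m * N * psym d m)ᵀ * Matrix.single a b 1).trace := by
      simp only [transpose_mul, psym_transpose]
      rw [← Matrix.mul_assoc, ← Matrix.mul_assoc, trace_mul_comm]
      simp only [Matrix.mul_assoc]
    rw [this, hN]
    simp [Matrix.trace_mul_single]
  ext a b
  rw [← hent M hM, ← hent M' hM']
  refine eq_of_eq_on_tensorPow
    ((traceLinearMap _ ℂ ℂ) ∘ₗ LinearMap.mulLeft ℂ Mᵀ)
    ((traceLinearMap _ ℂ ℂ) ∘ₗ LinearMap.mulLeft ℂ M'ᵀ) ?_ ?_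
  · intro φ ψ
    simp only [LinearMap.comp_apply, LinearMap.mulLeft_apply, traceLinearMap_apply, hform, h]
  · have := psym_mul_self d m
    calc _ = (psym d m * psym d m) * Matrix.single a b 1 * (psym d m * psym d m) := by
          simp only [Matrix.mul_assoc]
      _ = _ := by rw [this]

/-- The permanent of a matrix with two blocks of equal columns as a polynomial coefficient. -/
theorem choose_mul_sum_perm_prod_ite {m : ℕ} (T : Finset (Fin m)) (α β : Fin m → ℂ) :
    (m.choose T.card : ℂ) *
        ∑ π : Equiv.Perm (Fin m), ∏ t, (if π t ∈ T then α t else β t) =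
      m.factorial *
        (∏ t, (Polynomial.C (α t) * Polynomial.X + Polynomial.C (β t))).coeff T.card := by
  set F : Finset (Fin m) → ℂ := fun S => (∏ t ∈ S, α t) * ∏ t ∈ Finset.univ \ S, β t with hF
  have hprod : ∀ π : Equiv.Perm (Fin m), ∏ t, (if π t ∈ T then α t else β t) =
      F (T.map π⁻¹.toEmbedding) := by
    intro π
    rw [Finset.prod_ite, hF]
    have : Finset.univ.filter (fun t => π t ∈ T) = T.map π⁻¹.toEmbedding := by
      ext t
      rw [Finset.mem_map_equiv]
      simp [← Equiv.Perm.inv_def]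
    simp only [← this]
    congr 2
    ext t; simp
  have hcoeff : (∏ t, (Polynomial.C (α t) * Polynomial.X + Polynomial.C (β t))).coeff T.card =
      ∑ S ∈ Finset.univ.powersetCard T.card, F S := by
    rw [Finset.prod_add, Polynomial.finsetSum_coeff, Finset.powersetCard_eq_filter,
      Finset.sum_filter]
    refine Finset.sum_congr rfl fun S _ => ?_
    rw [Finset.prod_mul_distrib, Finset.prod_const, ← map_prod, ← map_prod, mul_right_comm,
      ← map_mul, Polynomial.coeff_C_mul_X_pow]
    simp only [hF, eq_comm]
  have hsum : ∀ S ∈ Finset.univ.powersetCard T.card,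
      ∑ π : Equiv.Perm (Fin m), F (S.map π.toEmbedding) =
        ∑ π : Equiv.Perm (Fin m), F (T.map π.toEmbedding) := by
    intro S hS
    obtain ⟨σ, hσ⟩ : ∃ σ : Equiv.Perm (Fin m), T.map σ.toEmbedding = S := by
      have hc := (Finset.mem_powersetCard.1 hS).2
      let e := Finset.equivOfCardEq hc.symm
      refine ⟨e.extendSubtype, ?_⟩
      refine Finset.eq_of_subset_of_card_le ?_ (by simp [hc])
      intro x hx
      obtain ⟨y, hy, rfl⟩ := Finset.mem_map.1 hx
      exact e.extendSubtype_mem y hy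
    refine Fintype.sum_equiv (Equiv.mulRight σ) _ _ fun π => ?_
    rw [← hσ, Finset.map_map]
    rfl
  have hinv : ∀ π : Equiv.Perm (Fin m),
      ∑ S ∈ Finset.univ.powersetCard T.card, F (S.map π.toEmbedding) =
        ∑ S ∈ Finset.univ.powersetCard T.card, F S := by
    intro π
    refine Finset.sum_bij' (fun S _ => S.map π.toEmbedding)
      (fun S _ => S.map π⁻¹.toEmbedding) ?_ ?_ ?_ ?_ ?_
    · intro S hS; simpa using hS
    · intro S hS; simpa using hS
    · intro S _; ext; simp [Finset.mem_map_equiv, ← Equiv.Perm.inv_def]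
    · intro S _; ext; simp [Finset.mem_map_equiv, ← Equiv.Perm.inv_def]
    · intros; rfl
  have hdouble := Finset.sum_congr (rfl : Finset.univ.powersetCard T.card = _) hsum
  rw [Finset.sum_comm, Finset.sum_congr rfl fun π _ => hinv π] at hdouble
  simp only [Finset.sum_const, Finset.card_univ, Fintype.card_perm, Fintype.card_fin,
    Finset.card_powersetCard, nsmul_eq_mul] at hdouble
  rw [hcoeff, hdouble]
  congr 1
  refine Fintype.sum_equiv (Equiv.inv _) _ _ fun π => ?_
  rw [hprod]
  rfl

theorem sum_choose_mul_coeff (n k : ℕ) (hkn : k ≤ n) (p q r s : ℂ) :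
    ∑ i : Fin (k + 1), (-1) ^ (i : ℕ) * (k.choose i : ℂ) * (s ^ (i : ℕ) *
      ((Polynomial.C p * Polynomial.X + Polynomial.C q) ^ n *
        (Polynomial.C r * Polynomial.X + Polynomial.C s) ^ (k - (i : ℕ))).coeff n) =
      n.choose k * (r ^ k * q ^ k * p ^ (n - k)) := by
  have hbin : ∑ i ∈ Finset.range (k + 1),
      Polynomial.C ((-1) ^ i * (k.choose i : ℂ) * s ^ i) *
        (Polynomial.C r * Polynomial.X + Polynomial.C s) ^ (k - i) =
      Polynomial.C (r ^ k) * Polynomial.X ^ k := by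
    have h := add_pow (-Polynomial.C s) (Polynomial.C r * Polynomial.X + Polynomial.C s) k
    rw [show -Polynomial.C s + (Polynomial.C r * Polynomial.X + Polynomial.C s) =
      Polynomial.C r * Polynomial.X by ring, mul_pow] at h
    rw [map_pow, h]
    refine Finset.sum_congr rfl fun i _ => ?_
    rw [neg_pow]
    simp only [map_mul, map_pow, map_neg, map_one, map_natCast]
    ring
  have hcoeff : ((Polynomial.C p * Polynomial.X + Polynomial.C q) ^ n).coeff (n - k) =
      p ^ (n - k) * q ^ k * n.choose k := by
    rw [add_pow, Polynomial.finsetSum_coeff, Finset.sum_eq_single (n - k)]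
    · rw [mul_pow, ← map_pow, ← map_pow, Nat.sub_sub_self hkn, Nat.choose_symm hkn,
        ← Polynomial.C_eq_natCast, mul_right_comm (Polynomial.C _), ← map_mul, mul_right_comm,
        ← map_mul,
        Polynomial.coeff_C_mul_X_pow, if_pos rfl]
    · intro b _ hb
      rw [mul_pow, ← map_pow, ← map_pow, 
        ← Polynomial.C_eq_natCast, mul_right_comm (Polynomial.C _), ← map_mul, mul_right_comm,
        ← map_mul,
        Polynomial.coeff_C_mul_X_pow, if_neg hb.symm]
    · intro h
      exact absurd (Finset.mem_range.2 (by omega)) h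
  rw [Finset.sum_range fun i => _] at hbin
  have h := congrArg
    (fun f => ((Polynomial.C p * Polynomial.X + Polynomial.C q) ^ n * f).coeff n) hbin
  simp only [Finset.mul_sum, Polynomial.finsetSum_coeff] at h
  rw [mul_left_comm, Polynomial.coeff_C_mul, Polynomial.coeff_mul_X_pow', if_pos hkn,
    hcoeff] at h
  rw [show (n.choose k : ℂ) * (r ^ k * q ^ k * p ^ (n - k)) =
    r ^ k * (p ^ (n - k) * q ^ k * n.choose k) by ring, ← h]
  refine Finset.sum_congr rfl fun i _ => ?_
  rw [mul_left_comm _ (Polynomial.C _), Polynomial.coeff_C_mul]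
  ring

theorem recast_mul (d : ℕ) {m m' : ℕ} (h : m = m') (M N : MatP d m) :
    recast d h (M * N) = recast d h M * recast d h N := by
  subst h; rfl

theorem recast_psym (d : ℕ) {m m' : ℕ} (h : m = m') :
    recast d h (psym d m) = psym d m' := by
  subst h; rfl

theorem symForm_recast {d m m' : ℕ} (h : m = m') (M : MatP d m) (u v : Fin d → ℂ) :
    symForm (recast d h M) u v = symForm M u v := by
  subst h; rfl

theorem recast_vecMulVec_tensorPow {d m m' : ℕ} (h : m = m') (u v : Fin d → ℂ) :
    recast d h (vecMulVec (tensorPow m u) (tensorPow m v)) =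
      vecMulVec (tensorPow m' u) (tensorPow m' v) := by
  subst h; rfl

theorem sum_fin_add_fun {α : Type*} [Fintype α] {p q : ℕ} (f : (Fin (p + q) → α) → ℂ) :
    ∑ e, f e = ∑ a : Fin p → α, ∑ c : Fin q → α, f (Fin.append a c) := by
  rw [← Fintype.sum_prod_type', ← (Fin.appendEquiv p q).sum_comp]
  rfl

theorem tensorPow_append {d p q : ℕ} (u : Fin d → ℂ) (a : Fin p → Fin d) (c : Fin q → Fin d) :
    tensorPow (p + q) u (Fin.append a c) = tensorPow p u a * tensorPow q u c := by
  simp [tensorPow, Fin.prod_univ_add]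

theorem sum_prod_mul_prod {d m : ℕ} (x y : Fin m → Fin d → ℂ) :
    ∑ e : Fin m → Fin d, (∏ t, x t (e t)) * ∏ t, y t (e t) = ∏ t, x t ⬝ᵥ y t := by
  simp only [dotProduct, Finset.prod_univ_sum, Fintype.piFinset_univ, Finset.prod_mul_distrib]

theorem tensorPow_dotProduct {d : ℕ} (m : ℕ) (u v : Fin d → ℂ) :
    tensorPow m u ⬝ᵥ tensorPow m v = (u ⬝ᵥ v) ^ m := by
  rw [dotProduct]
  simp only [tensorPow]
  rw [sum_prod_mul_prod (fun _ => u) fun _ => v]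
  simp

theorem symForm_smul {d m : ℕ} (c : ℂ) (M : MatP d m) (u v : Fin d → ℂ) :
    symForm (c • M) u v = c * symForm M u v := by
  simp [symForm, smul_mulVec]

theorem symForm_sum {ι : Type*} {d m : ℕ} (s : Finset ι) (M : ι → MatP d m)
    (u v : Fin d → ℂ) : symForm (∑ i ∈ s, M i) u v = ∑ i ∈ s, symForm (M i) u v := by
  simp [symForm, sum_mulVec, dotProduct_sum]

theorem symForm_eq_sum {d m : ℕ} (M : MatP d m) (u v : Fin d → ℂ) :
    symForm M u v = ∑ a, ∑ b, tensorPow m u a * M a b * tensorPow m v b := by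
  simp only [symForm, dotProduct, mulVec, Finset.mul_sum, mul_assoc]

theorem symForm_vecMulVec {d m : ℕ} (φ ψ u v : Fin d → ℂ) :
    symForm (vecMulVec (tensorPow m φ) (tensorPow m ψ)) u v =
      (u ⬝ᵥ φ) ^ m * (ψ ⬝ᵥ v) ^ m := by
  rw [symForm, vecMulVec_mulVec, dotProduct_smul, tensorPow_dotProduct, tensorPow_dotProduct]
  simp

theorem symForm_psym_mul_mul_psym {d m : ℕ} (M : MatP d m) (u v : Fin d → ℂ) :
    symForm (psym d m * M * psym d m) u v = symForm M u v := by
  rw [symForm, ← mulVec_mulVec, psym_mulVec_tensorPow, ← mulVec_mulVec, dotProduct_mulVec,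
    tensorPow_vecMul_psym, symForm]

theorem extendId_append {d p q : ℕ} (M : MatP d p) (a b : Fin p → Fin d)
    (c e : Fin q → Fin d) :
    extendId d p q M (Fin.append a c) (Fin.append b e) = M a b * if c = e then 1 else 0 := by
  simp [extendId, funext_iff]

theorem symForm_extendId {d p q : ℕ} (M : MatP d p) (u v : Fin d → ℂ) :
    symForm (extendId d p q M) u v = symForm M u v * (u ⬝ᵥ v) ^ q := by
  rw [symForm_eq_sum, symForm_eq_sum, sum_fin_add_fun, Finset.sum_mul]
  refine Finset.sum_congr rfl fun a _ => ?_
  simp_rw [sum_fin_add_fun (p := p) (q := q), extendId_append, tensorPow_append]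
  rw [Finset.sum_comm, Finset.sum_mul]
  refine Finset.sum_congr rfl fun b _ => ?_
  simp only [mul_ite, mul_one, mul_zero, ite_mul, zero_mul, Finset.sum_ite_eq, Finset.mem_univ,
    if_true]
  rw [← tensorPow_dotProduct, dotProduct, Finset.mul_sum]
  exact Finset.sum_congr rfl fun c _ => by ring

theorem symForm_clone {d s j : ℕ} (σ : MatP d s) (u v : Fin d → ℂ) :
    symForm (clone d s j σ) u v =
      (dsym d s : ℂ) / dsym d (s + j) * (symForm σ u v * (u ⬝ᵥ v) ^ j) := by
  rw [clone, symForm_smul, symForm_psym_mul_mul_psym, symForm_extendId]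

theorem psym_mul_clone_mul_psym (d s j : ℕ) (σ : MatP d s) :
    psym d (s + j) * clone d s j σ * psym d (s + j) = clone d s j σ := by
  have h := psym_mul_self d (s + j)
  simp only [clone, Matrix.mul_smul, Matrix.smul_mul]
  congr 1
  calc _ = (psym d (s + j) * psym d (s + j)) * extendId d s j σ *
        (psym d (s + j) * psym d (s + j)) := by simp only [Matrix.mul_assoc]
    _ = _ := by rw [h]

theorem trLastPart_vecMulVec_tensorPow {d p q : ℕ} (φ ψ : Fin d → ℂ) :
    trLastPart d p q (vecMulVec (tensorPow (p + q) φ) (tensorPow (p + q) ψ)) =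
      ((ψ ⬝ᵥ φ) ^ q) • vecMulVec (tensorPow p φ) (tensorPow p ψ) := by
  ext a b
  have h : ∀ (a : Fin p → Fin d) (c : Fin q → Fin d),
      Fin.addCases (motive := fun _ => Fin d) a c = Fin.append a c := fun _ _ => rfl
  simp only [trLastPart, h, Matrix.smul_apply, vecMulVec_apply, tensorPow_append, smul_eq_mul]
  rw [dotProduct_comm, ← tensorPow_dotProduct, dotProduct, Finset.sum_mul]
  exact Finset.sum_congr rfl fun c _ => by ring

/-- A matrix element of the symmetric projector between product vectors is a permanent. -/
theorem sum_prod_mul_psym_mulVec {d m : ℕ} (x y : Fin m → Fin d → ℂ) :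
    (fun e : Fin m → Fin d => ∏ t, x t (e t)) ⬝ᵥ
        (psym d m *ᵥ fun e => ∏ t, y t (e t)) =
      (m.factorial : ℂ)⁻¹ * ∑ π : Equiv.Perm (Fin m), ∏ t, x t ⬝ᵥ y (π t) := by
  simp only [dotProduct, psym_mulVec]
  simp_rw [mul_left_comm]
  rw [← Finset.mul_sum]
  congr 1
  simp_rw [Finset.mul_sum]
  rw [Finset.sum_comm]
  refine Fintype.sum_equiv (Equiv.inv _) _ _ fun π => ?_
  have h : ∀ e : Fin m → Fin d,
      ∏ t, y t ((e ∘ π) t) = ∏ t, y (π⁻¹ t) (e t) := by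
    intro e
    rw [← Equiv.prod_comp π fun t => y (π⁻¹ t) (e t)]
    simp
  simp_rw [h]
  exact sum_prod_mul_prod x fun t => y (π⁻¹ t)

theorem prod_append_apply {d p q : ℕ} (u v : Fin d → ℂ) (a : Fin p → Fin d)
    (c : Fin q → Fin d) :
    ∏ t, (Fin.append (fun _ => u) (fun _ => v) : Fin (p + q) → Fin d → ℂ) t (Fin.append a c t) =
      tensorPow p u a * tensorPow q v c := by
  simp [tensorPow, Fin.prod_univ_add]

theorem symForm_trFirstPart {d n j : ℕ} (φ ψ u v : Fin d → ℂ) :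
    symForm (trFirstPart d n j (psym d (n + j) *
        extendId d n j (vecMulVec (tensorPow n φ) (tensorPow n ψ)))) u v =
      (fun e : Fin (n + j) → Fin d =>
          ∏ t, (Fin.append (fun _ => ψ) (fun _ => u) : Fin (n + j) → Fin d → ℂ) t (e t)) ⬝ᵥ
        (psym d (n + j) *ᵥ fun e =>
          ∏ t, (Fin.append (fun _ => φ) (fun _ => v) : Fin (n + j) → Fin d → ℂ) t (e t)) := by
  have h : ∀ (a : Fin n → Fin d) (c : Fin j → Fin d),
      Fin.addCases (motive := fun _ => Fin d) a c = Fin.append a c := fun _ _ => rfl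
  simp only [dotProduct, mulVec]
  simp_rw [sum_fin_add_fun (p := n) (q := j), prod_append_apply]
  rw [symForm_eq_sum, Finset.sum_comm (s := (Finset.univ : Finset (Fin n → Fin d)))]
  refine Finset.sum_congr rfl fun a _ => ?_
  simp only [trFirstPart, h, mul_apply]
  simp_rw [sum_fin_add_fun (p := n) (q := j), extendId_append, vecMulVec_apply]
  simp only [mul_ite, mul_one, mul_zero, Finset.sum_ite_eq', Finset.mem_univ, if_true]
  simp only [Finset.mul_sum, Finset.sum_mul]
  rw [Finset.sum_comm]
  refine Finset.sum_congr rfl fun c _ => ?_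
  rw [Finset.sum_comm]
  refine Finset.sum_congr rfl fun c' _ => Finset.sum_congr rfl fun b _ => ?_
  ring

theorem symForm_MP {d n j : ℕ} (φ ψ u v : Fin d → ℂ) :
    symForm (MP d n j (vecMulVec (tensorPow n φ) (tensorPow n ψ))) u v =
      (dsym d n : ℂ) / dsym d (n + j) / (n + j).choose n *
      ((Polynomial.C (ψ ⬝ᵥ φ) * Polynomial.X + Polynomial.C (ψ ⬝ᵥ v)) ^ n *
        (Polynomial.C (u ⬝ᵥ φ) * Polynomial.X + Polynomial.C (u ⬝ᵥ v)) ^ j).coeff n := by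
  rw [MP, symForm_smul, symForm_trFirstPart, sum_prod_mul_psym_mulVec]
  set x : Fin (n + j) → Fin d → ℂ := Fin.append (fun _ => ψ) (fun _ => u) with hx
  set T : Finset (Fin (n + j)) := Finset.univ.map (Fin.castAddEmb j) with hT
  have hcard : T.card = n := by simp [hT]
  have hy : ∀ t i, x t ⬝ᵥ (Fin.append (fun _ => φ) (fun _ => v) : Fin (n + j) → Fin d → ℂ) i =
      if i ∈ T then x t ⬝ᵥ φ else x t ⬝ᵥ v := by
    intro t i
    refine Fin.addCases (fun i => ?_) (fun i => ?_) i
    · simp [hT]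
    · rw [if_neg]
      · simp
      · simp only [hT, Finset.mem_map, not_exists]
        rintro k ⟨_, hk⟩
        have := congrArg Fin.val hk
        simp at this
        omega
  simp_rw [hy]
  have h := choose_mul_sum_perm_prod_ite T (fun t => x t ⬝ᵥ φ) (fun t => x t ⬝ᵥ v)
  rw [hcard, Fin.prod_univ_add] at h
  simp only [hx, Fin.append_left, Fin.append_right, Finset.prod_const, Finset.card_univ,
    Fintype.card_fin] at h
  rw [← hx] at h
  generalize (∑ π : Equiv.Perm (Fin (n + j)), ∏ t, if π t ∈ T then x t ⬝ᵥ φ else x t ⬝ᵥ v) = P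
    at h ⊢
  have h0 : ((n + j).choose n : ℂ) ≠ 0 := by
    exact_mod_cast (Nat.choose_pos (Nat.le_add_right n j)).ne'
  have h1 : ((n + j).factorial : ℂ) ≠ 0 := by exact_mod_cast Nat.factorial_ne_zero _
  rw [eq_div_of_mul_eq h0 (mul_comm P _ |>.trans h), mul_div_assoc, inv_mul_cancel_left₀ h1]
  ring

theorem recast_add (d : ℕ) {m m' : ℕ} (h : m = m') (M N : MatP d m) :
    recast d h (M + N) = recast d h M + recast d h N := rfl

theorem recast_smul (d : ℕ) {m m' : ℕ} (h : m = m') (c : ℂ) (M : MatP d m) :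
    recast d h (c • M) = c • recast d h M := rfl

theorem extendId_add (d p q : ℕ) (M N : MatP d p) :
    extendId d p q (M + N) = extendId d p q M + extendId d p q N := by
  ext a b
  simp only [extendId, Matrix.add_apply, add_mul]

theorem extendId_smul (d p q : ℕ) (c : ℂ) (M : MatP d p) :
    extendId d p q (c • M) = c • extendId d p q M := by
  ext a b
  simp [extendId]

theorem trFirstPart_add (d p q : ℕ) (M N : MatP d (p + q)) :
    trFirstPart d p q (M + N) = trFirstPart d p q M + trFirstPart d p q N := by
  ext a b
  simp [trFirstPart, Finset.sum_add_distrib]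

theorem trFirstPart_smul (d p q : ℕ) (c : ℂ) (M : MatP d (p + q)) :
    trFirstPart d p q (c • M) = c • trFirstPart d p q M := by
  ext a b
  simp [trFirstPart, Finset.mul_sum]

theorem trLastPart_add (d p q : ℕ) (M N : MatP d (p + q)) :
    trLastPart d p q (M + N) = trLastPart d p q M + trLastPart d p q N := by
  ext a b
  simp [trLastPart, Finset.sum_add_distrib]

theorem trLastPart_smul (d p q : ℕ) (c : ℂ) (M : MatP d (p + q)) :
    trLastPart d p q (c • M) = c • trLastPart d p q M := by
  ext a b
  simp [trLastPart, Finset.mul_sum]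

theorem MP_add (d n j : ℕ) (M N : MatP d n) : MP d n j (M + N) = MP d n j M + MP d n j N := by
  simp only [MP, extendId_add, Matrix.mul_add, trFirstPart_add, smul_add]

theorem MP_smul (d n j : ℕ) (c : ℂ) (M : MatP d n) : MP d n j (c • M) = c • MP d n j M := by
  simp only [MP, extendId_smul, Matrix.mul_smul, trFirstPart_smul, smul_comm c]

theorem clone_add (d s j : ℕ) (M N : MatP d s) :
    clone d s j (M + N) = clone d s j M + clone d s j N := by
  simp only [clone, extendId_add, Matrix.mul_add, Matrix.add_mul, smul_add]

theorem clone_smul (d s j : ℕ) (c : ℂ) (M : MatP d s) :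
    clone d s j (c • M) = c • clone d s j M := by
  simp only [clone, extendId_smul, Matrix.mul_smul, Matrix.smul_mul, smul_comm c]

/-- The coefficient of `Clone_{k-s→k} ∘ MP_{n→k-s}` in the de Finetti expansion. -/
def deFinettiCoeff (d n k s : ℕ) : ℝ :=
  (-1) ^ s * k.choose s / n.choose k * (dsym d k / dsym d (k - s)) *
    (dsym d (n + (k - s)) / dsym d n) * (n + (k - s)).choose n

theorem ascFactorial_mul_le_descFactorial_mul (D n m : ℕ) (hm : m ≤ n) :
    ((D + n + 1).ascFactorial m : ℝ) * (n - m * (D + m)) ≤ n * n.descFactorial m := by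
  induction m with
  | zero => simp
  | succ m ih =>
    have ih := ih (by omega)
    have hnm : (m : ℝ) + 1 ≤ n := by exact_mod_cast hm
    have hD : (0 : ℝ) ≤ D := Nat.cast_nonneg D
    have hm0 : (0 : ℝ) ≤ m := Nat.cast_nonneg m
    rw [Nat.ascFactorial_succ, Nat.descFactorial_succ]
    push_cast [Nat.cast_sub (show m ≤ n by omega)]
    have hA : (0 : ℝ) ≤ ((D + n + 1).ascFactorial m : ℝ) := Nat.cast_nonneg _
    have h1 := mul_le_mul_of_nonneg_right ih (show (0 : ℝ) ≤ n - m by linarith)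
    have h2 : ((D : ℝ) + n + 1 + m) * (n - (m + 1) * (D + (m + 1))) ≤
        (n - m * (D + m)) * (n - m) := by
      have : 0 ≤ (m : ℝ) * (D + m) * m := by positivity
      nlinarith [mul_nonneg hm0 hD, mul_nonneg hm0 hm0, mul_nonneg hD hD,
        mul_nonneg (mul_nonneg hm0 hD) hD, mul_nonneg (mul_nonneg hm0 hm0) hD,
        mul_nonneg (mul_nonneg hm0 hm0) hm0]
    have h3 := mul_le_mul_of_nonneg_left h2 hA
    nlinarith

theorem deFinettiCoeff_abs_eq (D n j s : ℕ) (hkn : j + s ≤ n) :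
    |deFinettiCoeff (D + 1) n (j + s) s| =
      (j + s).choose s * (D + (j + s)).descFactorial s * (D + n + 1).ascFactorial j /
        (n.descFactorial j * (n - j).descFactorial s) := by
  obtain ⟨r, rfl⟩ := Nat.exists_eq_add_of_le hkn
  have hdsym : ∀ m, (dsym (D + 1) m : ℝ) = (m + D).factorial / (m.factorial * D.factorial) := by
    intro m
    rw [dsym, show D + 1 + m - 1 = m + D by omega, Nat.cast_add_choose]
  have h1 := Nat.factorial_mul_descFactorial (show s ≤ D + (j + s) by omega)
  have h2 := Nat.factorial_mul_ascFactorial (D + (j + s + r)) j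
  have h3 := Nat.factorial_mul_descFactorial (show j ≤ j + s + r by omega)
  have h4 := Nat.factorial_mul_descFactorial (show s ≤ s + r by omega)
  rw [show j + s + r - j = s + r by omega] at *
  rw [show s + r - s = r by omega] at h4
  rw [show D + (j + s) - s = j + D by omega] at h1
  unfold deFinettiCoeff
  rw [show j + s - s = j by omega, hdsym, hdsym, hdsym, hdsym, Nat.cast_add_choose,
    Nat.cast_add_choose, Nat.add_comm j s, Nat.cast_add_choose, abs_mul, abs_mul, abs_mul,
    abs_div, abs_mul, abs_pow, abs_neg, abs_one, one_pow, one_mul]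
  simp only [Nat.abs_cast, abs_div, abs_mul]
  rw [show j + s + r = s + j + r by omega] at h2 h3
  rw [show D + (s + j + r) + j = s + j + r + j + D by omega] at h2
  rw [show D + (j + s) = D + (s + j) by omega] at h1
  have p1 : ((s + j + D).factorial : ℝ) = (j + D).factorial * (D + (s + j)).descFactorial s := by
    rw [show s + j + D = D + (s + j) by omega, ← h1]; push_cast; rfl
  have p2 : ((s + j + r + j + D).factorial : ℝ) =
      (s + j + r + D).factorial * (D + (s + j + r) + 1).ascFactorial j := by
    rw [← h2, show s + j + r + D = D + (s + j + r) by omega]; push_cast; rfl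
  have p3 : ((s + j + r).factorial : ℝ) =
      r.factorial * (s + r).descFactorial s * (s + j + r).descFactorial j := by
    rw [← h3, ← h4]; push_cast; rfl
  have q3 : ((s + j + r).descFactorial j : ℝ) ≠ 0 := by
    exact_mod_cast (Nat.descFactorial_pos.2 (by omega)).ne'
  have q4 : ((s + r).descFactorial s : ℝ) ≠ 0 := by
    exact_mod_cast (Nat.descFactorial_pos.2 (by omega)).ne'
  rw [p1, p2, p3]
  have hf : ∀ m : ℕ, (m.factorial : ℝ) ≠ 0 := fun m => by exact_mod_cast m.factorial_ne_zero
  field_simp [hf]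

theorem abs_deFinettiCoeff_le (d n k s : ℕ) (hd : 1 ≤ d) (hk : 1 ≤ k) (hkn : k ≤ n)
    (hδ : ((k : ℝ) * (d + k)) / n < 1) (hs : s ≤ k) :
    |deFinettiCoeff d n k s| ≤ (2 * (((k : ℝ) * (d + k)) / n)) ^ s /
          (1 - ((k : ℝ) * (d + k)) / n) := by
  obtain ⟨D, rfl⟩ := Nat.exists_eq_add_of_le' hd
  obtain ⟨j, rfl⟩ := Nat.exists_eq_add_of_le' hs
  have hn : 0 < n := by omega
  have hn' : (0 : ℝ) < n := by exact_mod_cast hn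
  rw [deFinettiCoeff_abs_eq D n j s hkn]
  have hδ' : (((j + s : ℕ) : ℝ) * ((D + 1 : ℕ) + (j + s : ℕ))) < n := by
    rwa [div_lt_one hn'] at hδ
  have hnat : (j + s) * (D + 1 + (j + s)) < n := by exact_mod_cast hδ'
  have h2k : 2 * (j + s) ≤ n := by nlinarith
  have hjR : (j : ℝ) * (D + j) ≤ ((j + s : ℕ) : ℝ) * ((D + 1 : ℕ) + (j + s : ℕ)) := by
    have : j * (D + j) ≤ (j + s) * (D + 1 + (j + s)) :=
      Nat.mul_le_mul (by omega) (by omega)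
    exact_mod_cast this
  have hc : ((j + s).choose s : ℝ) ≤ ((j + s : ℕ) : ℝ) ^ s := by
    exact_mod_cast Nat.choose_le_pow _ _
  have hdf : ((D + (j + s)).descFactorial s : ℝ) ≤ ((D + 1 : ℕ) + (j + s : ℕ) : ℝ) ^ s := by
    have : (D + (j + s)).descFactorial s ≤ (D + 1 + (j + s)) ^ s :=
      (Nat.descFactorial_le_pow _ _).trans (Nat.pow_le_pow_left (by omega) _)
    exact_mod_cast this
  have hR : ((n : ℝ) / 2) ^ s ≤ ((n - j).descFactorial s : ℝ) := by
    have h1 : (n - j + 1 - s) ^ s ≤ (n - j).descFactorial s := Nat.pow_sub_le_descFactorial _ _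
    have h2 : (n : ℝ) / 2 ≤ ((n - j + 1 - s : ℕ) : ℝ) := by
      have : n ≤ 2 * (n - j + 1 - s) := by omega
      have : (n : ℝ) ≤ 2 * ((n - j + 1 - s : ℕ) : ℝ) := by exact_mod_cast this
      linarith
    calc ((n : ℝ) / 2) ^ s ≤ ((n - j + 1 - s : ℕ) : ℝ) ^ s := by gcongr
      _ ≤ _ := by exact_mod_cast h1
  have hAB := ascFactorial_mul_le_descFactorial_mul D n j (by omega)
  set w : ℝ := ((j + s : ℕ) : ℝ) * ((D + 1 : ℕ) + (j + s : ℕ)) with hw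
  have hw1 : 0 < 1 - w / n := by
    rw [sub_pos]; exact hδ
  have hB : (0 : ℝ) < n.descFactorial j := by
    exact_mod_cast Nat.descFactorial_pos.2 (by omega)
  have hratio : ((D + n + 1).ascFactorial j : ℝ) / n.descFactorial j ≤ 1 / (1 - w / n) := by
    rw [div_le_div_iff₀ hB hw1, one_mul, ← mul_le_mul_iff_left₀ hn', mul_assoc,
      sub_mul, div_mul_cancel₀ _ hn'.ne', one_mul, mul_comm _ (n : ℝ)]
    refine le_trans (mul_le_mul_of_nonneg_left ?_ (Nat.cast_nonneg _)) hAB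
    linarith
  calc _ = ((j + s).choose s * (D + (j + s)).descFactorial s / (n - j).descFactorial s : ℝ) *
        ((D + n + 1).ascFactorial j / n.descFactorial j) := by
        rw [div_mul_div_comm, mul_comm ((n.descFactorial j : ℕ) : ℝ)]
    _ ≤ (((j + s : ℕ) : ℝ) ^ s * ((D + 1 : ℕ) + (j + s : ℕ) : ℝ) ^ s / ((n : ℝ) / 2) ^ s) *
        (1 / (1 - w / n)) := by
        gcongr
    _ = _ := by
        rw [← mul_pow, ← hw, ← div_pow, mul_one_div]
        congr 2
        field_simp

/-- Exponential de Finetti theorem (tensor-power version): with `δ = k(d+k)/n < 1`, there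
are reals `x_0,…,x_k` with `|x_s| ≤ (2δ)^s/(1-δ)` such that for every symmetric operator
`ρ` on `n` qudits, `tr_{last n-k}(ρ) = ∑_{s=0}^k x_s Clone_{k-s→k}(MP_{n→k-s}(ρ))`. -/
theorem exponential_deFinetti
    (d n k : ℕ) (hd : 1 ≤ d) (hk : 1 ≤ k) (hkn : k ≤ n)
    (hδ : ((k : ℝ) * (d + k)) / n < 1) :
    ∃ x : Fin (k + 1) → ℝ,
      (∀ s : Fin (k + 1),
        |x s| ≤ (2 * (((k : ℝ) * (d + k)) / n)) ^ (s : ℕ) /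
          (1 - ((k : ℝ) * (d + k)) / n)) ∧
      ∀ ρ : MatP d n, psym d n * ρ * psym d n = ρ →
        trLastPart d k (n - k) (recast d (Nat.add_sub_cancel' hkn).symm ρ) =
          ∑ s : Fin (k + 1),
            ((x s : ℂ)) •
              recast d (Nat.sub_add_cancel (Nat.le_of_lt_succ s.isLt))
                (clone d (k - (s : ℕ)) (s : ℕ) (MP d n (k - (s : ℕ)) ρ)) := by
  refine ⟨fun s => deFinettiCoeff d n k s, fun s =>
    abs_deFinettiCoeff_le d n k s hd hk hkn hδ (Nat.le_of_lt_succ s.isLt), fun ρ hρ => ?_⟩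
  refine eq_of_eq_on_tensorPow
    (IsLinearMap.mk' (fun ρ => trLastPart d k (n - k)
      (recast d (Nat.add_sub_cancel' hkn).symm ρ)) ⟨?_, ?_⟩)
    (IsLinearMap.mk' (fun ρ => ∑ s : Fin (k + 1), ((deFinettiCoeff d n k s : ℝ) : ℂ) •
      recast d (Nat.sub_add_cancel (Nat.le_of_lt_succ s.isLt))
        (clone d (k - (s : ℕ)) (s : ℕ) (MP d n (k - (s : ℕ)) ρ))) ⟨?_, ?_⟩) ?_ hρ
  · intro x y
    rw [recast_add, trLastPart_add]
  · intro c x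
    rw [recast_smul, trLastPart_smul]
  · intro x y
    simp only [MP_add, clone_add, recast_add, smul_add, Finset.sum_add_distrib]
  · intro c x
    simp only [MP_smul, clone_smul, recast_smul, Finset.smul_sum, smul_comm c]
  intro φ ψ
  simp only [IsLinearMap.mk'_apply]
  rw [recast_vecMulVec_tensorPow, trLastPart_vecMulVec_tensorPow]
  apply eq_of_symForm_eq
  · rw [Matrix.mul_smul, Matrix.smul_mul, mul_vecMulVec, vecMulVec_mul, psym_mulVec_tensorPow,
      tensorPow_vecMul_psym]
  · simp only [Matrix.mul_sum, Matrix.sum_mul, Matrix.mul_smul, Matrix.smul_mul]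
    refine Finset.sum_congr rfl fun s _ => ?_
    rw [← recast_psym d (Nat.sub_add_cancel (Nat.le_of_lt_succ s.isLt)), ← recast_mul,
      ← recast_mul, psym_mul_clone_mul_psym]
  intro u v
  rw [symForm_smul, symForm_vecMulVec, symForm_sum]
  have hchoose : (n.choose k : ℂ) ≠ 0 := by exact_mod_cast (Nat.choose_pos hkn).ne'
  have hdsym : ∀ m, (dsym d m : ℂ) ≠ 0 := fun m => by
    exact_mod_cast (Nat.choose_pos (show m ≤ d + m - 1 by omega)).ne'
  have hmain := sum_choose_mul_coeff n k hkn (ψ ⬝ᵥ φ) (ψ ⬝ᵥ v) (u ⬝ᵥ φ) (u ⬝ᵥ v)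
  rw [mul_comm, ← mul_right_inj' hchoose, ← hmain, Finset.mul_sum]
  refine Finset.sum_congr rfl fun s _ => ?_
  have hc : ((n + (k - (s : ℕ))).choose n : ℂ) ≠ 0 := by
    exact_mod_cast (Nat.choose_pos (Nat.le_add_right _ _)).ne'
  rw [symForm_smul, symForm_recast, symForm_clone, symForm_MP,
    Nat.sub_add_cancel (Nat.le_of_lt_succ s.isLt), deFinettiCoeff]
  push_cast
  have h1 := hdsym k
  have h2 := hdsym (k - s)
  have h3 := hdsym n
  have h4 := hdsym (n + (k - s))
  field_simp
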